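/- Let a, A, H, B, G : ℝ × ℝ → ℝ with a continuously differentiable and nowhere zero. Define γ = (A + a·G − (a_t + a·a_x))/(2a) and η = −(A − a·G + (a_t − a·a_x))/(2a), and assume the structural conditions γ_t + a·γ_x = H + G·γ − γ² and η_t − a·η_x = H + G·η − η² hold at every point. Let α, β : ℝ × ℝ → ℝ be continuously differentiable with α_t + a·α_x = B + (G − γ)·α and β_t − a·β_x = B + (G − η)·β at every point. Let u₁, u₂ : ℝ × ℝ → ℝ be twice continuously differentiable solutions of the two intermediate integrals (u₁)_t − a·(u₁)_x = γ·u₁ + α and (u₂)_t + a·(u₂)_x = η·u₂ + β. Then the function u = (u₁ + u₂)/2 satisfies the linear hyperbolic equation u_tt − a²·u_xx = A·u_x + H·u + B + G·u_t at every point (x,t). -/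

import Mathlib

/-- Partial derivative of `v(x,t)` with respect to the first argument `x`. -/
noncomputable def px (v : ℝ × ℝ → ℝ) (p : ℝ × ℝ) : ℝ := fderiv ℝ v p (1, 0)

/-- Partial derivative of `v(x,t)` with respect to the second argument `t`. -/
noncomputable def pt (v : ℝ × ℝ → ℝ) (p : ℝ × ℝ) : ℝ := fderiv ℝ v p (0, 1)

theorem px_add {v w : ℝ × ℝ → ℝ} {p : ℝ × ℝ} (hv : DifferentiableAt ℝ v p)
    (hw : DifferentiableAt ℝ w p) : px (fun q => v q + w q) p = px v p + px w p := by
  simp [px, fderiv_fun_add hv hw]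

theorem pt_add {v w : ℝ × ℝ → ℝ} {p : ℝ × ℝ} (hv : DifferentiableAt ℝ v p)
    (hw : DifferentiableAt ℝ w p) : pt (fun q => v q + w q) p = pt v p + pt w p := by
  simp [pt, fderiv_fun_add hv hw]

theorem px_mul {v w : ℝ × ℝ → ℝ} {p : ℝ × ℝ} (hv : DifferentiableAt ℝ v p)
    (hw : DifferentiableAt ℝ w p) :
    px (fun q => v q * w q) p = v p * px w p + w p * px v p := by
  simp [px, fderiv_fun_mul hv hw]

theorem pt_mul {v w : ℝ × ℝ → ℝ} {p : ℝ × ℝ} (hv : DifferentiableAt ℝ v p)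
    (hw : DifferentiableAt ℝ w p) :
    pt (fun q => v q * w q) p = v p * pt w p + w p * pt v p := by
  simp [pt, fderiv_fun_mul hv hw]

theorem px_neg (v : ℝ × ℝ → ℝ) (p : ℝ × ℝ) : px (fun q => -v q) p = -px v p := by
  simp [px, fderiv_fun_neg]

theorem pt_neg (v : ℝ × ℝ → ℝ) (p : ℝ × ℝ) : pt (fun q => -v q) p = -pt v p := by
  simp [pt, fderiv_fun_neg]

theorem px_half_add {v w : ℝ × ℝ → ℝ} (hv : Differentiable ℝ v) (hw : Differentiable ℝ w) :
    px (fun q => (v q + w q) / 2) = fun q => (px v q + px w q) / 2 := by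
  funext p
  simp only [px, div_eq_mul_inv]
  rw [fderiv_mul_const ((hv p).fun_add (hw p)), fderiv_fun_add (hv p) (hw p)]
  simp [mul_comm, mul_add]

theorem pt_half_add {v w : ℝ × ℝ → ℝ} (hv : Differentiable ℝ v) (hw : Differentiable ℝ w) :
    pt (fun q => (v q + w q) / 2) = fun q => (pt v q + pt w q) / 2 := by
  funext p
  simp only [pt, div_eq_mul_inv]
  rw [fderiv_mul_const ((hv p).fun_add (hw p)), fderiv_fun_add (hv p) (hw p)]
  simp [mul_comm, mul_add]

theorem differentiable_px {v : ℝ × ℝ → ℝ} (hv : ContDiff ℝ 2 v) : Differentiable ℝ (px v) :=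
  ((hv.fderiv_right (m := 1) (by norm_num)).differentiable one_ne_zero).clm_apply
    (differentiable_const _)

theorem differentiable_pt {v : ℝ × ℝ → ℝ} (hv : ContDiff ℝ 2 v) : Differentiable ℝ (pt v) :=
  ((hv.fderiv_right (m := 1) (by norm_num)).differentiable one_ne_zero).clm_apply
    (differentiable_const _)

/-- Symmetry of the mixed second partial derivatives. -/
theorem px_pt_comm {v : ℝ × ℝ → ℝ} (hv : ContDiff ℝ 2 v) (p : ℝ × ℝ) :
    px (pt v) p = pt (px v) p := by
  have hd : DifferentiableAt ℝ (fderiv ℝ v) p :=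
    (hv.fderiv_right (m := 1) (by norm_num)).differentiable one_ne_zero p
  have key (e f : ℝ × ℝ) :
      fderiv ℝ (fun q => fderiv ℝ v q e) p f = fderiv ℝ (fderiv ℝ v) p f e := by
    rw [fderiv_clm_apply hd (differentiableAt_const e)]
    simp
  have hsymm : IsSymmSndFDerivAt ℝ v p := hv.contDiffAt.isSymmSndFDerivAt (by simp)
  exact (key _ _).trans ((hsymm _ _).trans (key _ _).symm)

/-- A solution of the intermediate integral `v_t − a v_x = γ v + α` solves the second-order
equation `v_tt − a² v_xx = A v_x + H v + B + G v_t`. -/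
theorem hyperbolic_of_intermediate_integral
    {a A H B G γ α v : ℝ × ℝ → ℝ}
    (ha : Differentiable ℝ a) (hγ : Differentiable ℝ γ) (hα : Differentiable ℝ α)
    (hv : ContDiff ℝ 2 v)
    (hγdef : ∀ p, 2 * a p * γ p = A p + a p * G p - (pt a p + a p * px a p))
    (hstruct : ∀ p, pt γ p + a p * px γ p = H p + G p * γ p - (γ p) ^ 2)
    (hαeq : ∀ p, pt α p + a p * px α p = B p + (G p - γ p) * α p)
    (heq : ∀ p, pt v p - a p * px v p = γ p * v p + α p) (p : ℝ × ℝ) :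
    pt (pt v) p - (a p) ^ 2 * px (px v) p = A p * px v p + H p * v p + B p + G p * pt v p := by
  have hvd : Differentiable ℝ v := hv.differentiable two_ne_zero
  have hvx := differentiable_px hv
  have hfun : pt v = fun q => a q * px v q + (γ q * v q + α q) := by
    funext q
    linear_combination heq q
  have hγv := (hγ p).fun_mul (hvd p)
  have ht : pt (pt v) p = a p * pt (px v) p + px v p * pt a p
      + (γ p * pt v p + v p * pt γ p + pt α p) := by
    conv_lhs => rw [hfun]
    rw [pt_add ((ha p).fun_mul (hvx p)) (hγv.fun_add (hα p)), pt_add hγv (hα p),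
      pt_mul (ha p) (hvx p), pt_mul (hγ p) (hvd p)]
  have hx : px (pt v) p = a p * px (px v) p + px v p * px a p
      + (γ p * px v p + v p * px γ p + px α p) := by
    conv_lhs => rw [hfun]
    rw [px_add ((ha p).fun_mul (hvx p)) (hγv.fun_add (hα p)), px_add hγv (hα p),
      px_mul (ha p) (hvx p), px_mul (hγ p) (hvd p)]
  linear_combination ht + a p * hx - a p * px_pt_comm hv p + v p * hstruct p + hαeq p
    + px v p * hγdef p - (G p - γ p) * heq p

/-- General solution of the linear hyperbolic equation
`u_tt − a²u_xx = Au_x + Hu + B + Gu_t` as the combination `u = (u₁ + u₂)/2` of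
solutions of the two intermediate integrals `(u₁)_t − a(u₁)_x = γu₁ + α` and
`(u₂)_t + a(u₂)_x = ηu₂ + β`. -/
theorem linear_hyperbolic_general_solution
    (a A H B G γ η α β : ℝ × ℝ → ℝ)
    (ha : ContDiff ℝ 1 a) (hane : ∀ p : ℝ × ℝ, a p ≠ 0)
    (hγdef : ∀ p : ℝ × ℝ,
      γ p = (A p + a p * G p - (pt a p + a p * px a p)) / (2 * a p))
    (hηdef : ∀ p : ℝ × ℝ,
      η p = -(A p - a p * G p + (pt a p - a p * px a p)) / (2 * a p))
    (hγ : ContDiff ℝ 1 γ) (hη : ContDiff ℝ 1 η)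
    (hstructγ : ∀ p : ℝ × ℝ,
      pt γ p + a p * px γ p = H p + G p * γ p - (γ p)^2)
    (hstructη : ∀ p : ℝ × ℝ,
      pt η p - a p * px η p = H p + G p * η p - (η p)^2)
    (hα : ContDiff ℝ 1 α) (hβ : ContDiff ℝ 1 β)
    (hαeq : ∀ p : ℝ × ℝ, pt α p + a p * px α p = B p + (G p - γ p) * α p)
    (hβeq : ∀ p : ℝ × ℝ, pt β p - a p * px β p = B p + (G p - η p) * β p)
    (u₁ u₂ : ℝ × ℝ → ℝ) (hu₁ : ContDiff ℝ 2 u₁) (hu₂ : ContDiff ℝ 2 u₂)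
    (heq₁ : ∀ p : ℝ × ℝ, pt u₁ p - a p * px u₁ p = γ p * u₁ p + α p)
    (heq₂ : ∀ p : ℝ × ℝ, pt u₂ p + a p * px u₂ p = η p * u₂ p + β p)
    (u : ℝ × ℝ → ℝ) (hu : ∀ p : ℝ × ℝ, u p = (u₁ p + u₂ p) / 2) :
    ∀ p : ℝ × ℝ,
      pt (pt u) p - (a p)^2 * px (px u) p =
        A p * px u p + H p * u p + B p + G p * pt u p := by
  have had : Differentiable ℝ a := ha.differentiable one_ne_zero
  have h₁ := hyperbolic_of_intermediate_integral (A := A) (B := B) (G := G) (H := H) had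
    (hγ.differentiable one_ne_zero) (hα.differentiable one_ne_zero) hu₁
    (fun p => by rw [hγdef p]; field_simp [hane p]) hstructγ hαeq heq₁
  have h₂ := hyperbolic_of_intermediate_integral (a := fun q => -a q) (A := A) (B := B) (G := G)
    (H := H) had.fun_neg
    (hη.differentiable one_ne_zero) (hβ.differentiable one_ne_zero) hu₂
    (fun p => by
      rw [hηdef p, px_neg, pt_neg]
      have := hane p
      field_simp
      ring)
    (fun p => by linear_combination hstructη p)
    (fun p => by linear_combination hβeq p)
    (fun p => by linear_combination heq₂ p)
  obtain rfl : u = fun q => (u₁ q + u₂ q) / 2 := funext hu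
  intro p
  have hd₁ := hu₁.differentiable two_ne_zero
  have hd₂ := hu₂.differentiable two_ne_zero
  rw [px_half_add hd₁ hd₂, pt_half_add hd₁ hd₂,
    px_half_add (differentiable_px hu₁) (differentiable_px hu₂),
    pt_half_add (differentiable_pt hu₁) (differentiable_pt hu₂)]
  linear_combination (h₁ p + h₂ p) / 2
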